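/- There is no factorization G = AB of the group G = PSL(2,8) : 3 (the extension of PSL(2,8) by a field automorphism of order 3, i.e. Aut(PSL(2,8))) with A and B proper subgroups of G satisfying |A| = |B|. -/

import Mathlib

open scoped Pointwise MatrixGroups

section GroupTheory

variable {G : Type*} [Group G]

theorem Subgroup.card_eq_index_mul_card_inf_of_mul_eq_univ {A B : Subgroup G}
    (h : (A : Set G) * (B : Set G) = Set.univ) :
    Nat.card A = B.index * Nat.card (A ⊓ B : Subgroup G) := by
  have : MulAction.IsPretransitive A (G ⧸ B) := by
    rw [MulAction.isPretransitive_iff_base ((1 : G) : G ⧸ B)]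
    intro q
    obtain ⟨g, rfl⟩ := QuotientGroup.mk_surjective q
    obtain ⟨a, ha, b, hb, rfl⟩ : g ∈ (A : Set G) * (B : Set G) := h ▸ Set.mem_univ g
    refine ⟨⟨a, ha⟩, ?_⟩
    change ((a * 1 : G) : G ⧸ B) = _
    rw [QuotientGroup.eq]
    simpa using hb
  have hstab : MulAction.stabilizer A ((1 : G) : G ⧸ B) = B.subgroupOf A := by
    ext a
    rw [MulAction.mem_stabilizer_iff, Subgroup.mem_subgroupOf]
    change ((a * 1 : G) : G ⧸ B) = _ ↔ _
    rw [eq_comm, QuotientGroup.eq]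
    simp
  have hidx := MulAction.index_stabilizer_of_transitive A ((1 : G) : G ⧸ B)
  rw [hstab] at hidx
  rw [← Subgroup.card_mul_index (B.subgroupOf A), hidx, mul_comm, Subgroup.index,
    ← Subgroup.inf_subgroupOf_left,
    Nat.card_congr (Subgroup.subgroupOfEquivOfLe (inf_le_left : A ⊓ B ≤ A)).toEquiv]

theorem Subgroup.range_le_of_not_card_dvd_index_factorial {S : Type*} [Group S]
    [IsSimpleGroup S] (f : S →* G) (A : Subgroup G) [A.FiniteIndex]
    (h : ¬ Nat.card S ∣ A.index.factorial) : f.range ≤ A := by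
  let φ : S →* Equiv.Perm (G ⧸ A) := (MulAction.toPermHom G (G ⧸ A)).comp f
  rcases IsSimpleGroup.eq_bot_or_eq_top_of_normal φ.ker inferInstance with hφ | hφ
  · have := Subgroup.card_dvd_of_injective φ ((MonoidHom.ker_eq_bot_iff φ).1 hφ)
    rw [Nat.card_perm] at this
    exact absurd this h
  · rintro _ ⟨s, rfl⟩
    have hs : s ∈ φ.ker := hφ ▸ Subgroup.mem_top s
    have h1 : f s • ((1 : G) : G ⧸ A) = ((1 : G) : G ⧸ A) :=
      congrArg (fun σ : Equiv.Perm (G ⧸ A) => σ ((1 : G) : G ⧸ A)) (MonoidHom.mem_ker.1 hs)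
    change ((f s * 1 : G) : G ⧸ A) = _ at h1
    rw [eq_comm, QuotientGroup.eq] at h1
    simpa using h1

theorem Subgroup.card_ne_card_of_mul_eq_univ_of_isSimpleGroup {S : Type*} [Group S]
    [IsSimpleGroup S] (f : S →* G) (hf : Function.Injective f) (hS : Nat.card S = 504)
    (hG : Nat.card G ∣ 1512) {A B : Subgroup G} (hA : A ≠ ⊤) (hB : B ≠ ⊤)
    (h : (A : Set G) * (B : Set G) = Set.univ) : Nat.card A ≠ Nat.card B := by
  intro hAB
  have : Finite G := Nat.finite_of_card_ne_zero (by rintro h0; simp [h0] at hG)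
  have hindex : A.index = B.index := by
    have hA' := A.card_mul_index
    rw [hAB, ← B.card_mul_index] at hA'
    exact Nat.eq_of_mul_eq_mul_left Nat.card_pos hA'
  have hsq : A.index ^ 2 ∣ 1512 := by
    refine dvd_trans ⟨Nat.card (A ⊓ B : Subgroup G), ?_⟩ hG
    rw [← A.card_mul_index, card_eq_index_mul_card_inf_of_mul_eq_univ h, hindex]
    ring
  have hle : A.index ≤ 6 := by
    have : A.index ≤ 38 := by
      have := Nat.le_of_dvd (by norm_num) hsq
      nlinarith
    generalize A.index = n at *
    clear hindex
    interval_cases n <;> revert hsq <;> decide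
  have hfact : ¬ Nat.card S ∣ A.index.factorial := fun hdvd => by
    rw [hS] at hdvd
    exact absurd (hdvd.trans (Nat.factorial_dvd_factorial hle)) (by decide)
  have hrange : ∀ C : Subgroup G, C ≠ ⊤ → ¬ Nat.card S ∣ C.index.factorial → C = f.range := by
    intro C hC hdvd
    have hle := range_le_of_not_card_dvd_index_factorial f C hdvd
    refine (Subgroup.eq_of_le_of_card_ge hle ?_).symm
    have hcard : Nat.card f.range = 504 := by
      rw [← hS]; exact (Nat.card_congr (MonoidHom.ofInjective hf).toEquiv).symm
    obtain ⟨j, hj⟩ := hcard ▸ Subgroup.card_dvd_of_le hle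
    have hC1 : C.index ≠ 1 := fun h1 => hC (Subgroup.index_eq_one.1 h1)
    have hC0 : C.index ≠ 0 := Subgroup.index_ne_zero_of_finite
    have hG' := Nat.le_of_dvd (by norm_num) hG
    rw [← C.card_mul_index, hj] at hG'
    rw [hcard, hj]
    have : 2 ≤ C.index := by omega
    have : j * C.index ≤ 3 := by nlinarith
    have : j ≤ 1 := by nlinarith
    omega
  have hA' := hrange A hA hfact
  have hB' := hrange B hB (hindex ▸ hfact)
  rw [hA', hB', ← hA', coe_mul_coe] at h
  exact hA (SetLike.coe_injective (by simpa using h))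

theorem card_dvd_card_of_forall_stabilizer_eq_bot (X : Type*) [MulAction G X]
    (h : ∀ x : X, MulAction.stabilizer G x = ⊥) : Nat.card G ∣ Nat.card X := by
  rw [Nat.card_congr (MulAction.selfEquivSigmaOrbitsQuotientStabilizer G X),
    Nat.card_congr (Equiv.sigmaCongrRight fun ω : Quotient (MulAction.orbitRel G X) =>
      (Subgroup.quotientEquivOfEq (h ω.out)).trans QuotientGroup.quotientBot.toEquiv),
    Nat.card_congr (Equiv.sigmaEquivProd _ _), Nat.card_prod]
  exact dvd_mul_left _ _

/-- If `X` is a set of generating pairs that is stable under automorphisms, then the automorphism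
group acts freely on `X`. -/
theorem MulAut.card_dvd_card_of_closure_eq_top {X : Set (G × G)}
    (hX : ∀ (φ : MulAut G), ∀ p ∈ X, φ • p ∈ X)
    (hgen : ∀ p ∈ X, Subgroup.closure {p.1, p.2} = ⊤) : Nat.card (MulAut G) ∣ Nat.card X := by
  let Y : SubMulAction (MulAut G) (G × G) := ⟨X, fun φ p hp => hX φ p hp⟩
  refine card_dvd_card_of_forall_stabilizer_eq_bot (G := MulAut G) Y fun p => ?_
  rw [eq_bot_iff]
  intro φ hφ
  have hp : φ • (p : G × G) = p := congrArg Subtype.val hφ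
  refine MulEquiv.toMonoidHom_injective ?_
  refine MonoidHom.eq_of_eqOn_dense (hgen p p.2) ?_
  rintro g (rfl | rfl)
  · exact congrArg Prod.fst hp
  · exact congrArg Prod.snd hp

end GroupTheory

section FieldOfOrderEight

variable {K : Type*} [Field K]

theorem pow_card_eight (hK : Nat.card K = 8) (z : K) : z ^ 8 = z := by
  have : Finite K := Nat.finite_of_card_ne_zero (by omega)
  have := Fintype.ofFinite K
  rw [← hK, Nat.card_eq_fintype_card, FiniteField.pow_card]

variable [CharP K 2]

theorem exists_cube_eq_add_one (hK : Nat.card K = 8) : ∃ c : K, c ^ 3 = c + 1 := by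
  have : Finite K := Nat.finite_of_card_ne_zero (by omega)
  have := Fintype.ofFinite K
  classical
  obtain ⟨x, hx⟩ : ∃ x, x ∉ ({0, 1} : Finset K) := by
    by_contra! h
    have := Finset.card_le_card (fun x _ => h x : (Finset.univ : Finset K) ⊆ {0, 1})
    rw [Finset.card_univ, ← Nat.card_eq_fintype_card, hK] at this
    exact absurd (this.trans Finset.card_le_two) (by norm_num)
  simp only [Finset.mem_insert, Finset.mem_singleton, not_or] at hx
  have h8 := pow_card_eight hK x
  have h : x * (x + 1) * (x ^ 3 + x + 1) * (x ^ 3 + x ^ 2 + 1) = 0 := by grind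
  have hx1 : x + 1 ≠ 0 := by grind
  simp only [mul_eq_zero, hx.1, hx1, false_or] at h
  rcases h with h | h
  · exact ⟨x, by grind⟩
  · exact ⟨x + 1, by grind⟩

theorem natCard_cube_eq_add_one (hK : Nat.card K = 8) :
    Nat.card {c : K // c ^ 3 = c + 1} = 3 := by
  obtain ⟨α, hα⟩ := exists_cube_eq_add_one hK
  classical
  have h : {c : K | c ^ 3 = c + 1} = ({α, α ^ 2, α ^ 2 + α} : Finset K) := by
    ext c
    have hc : c ^ 3 - (c + 1) = (c - α) * (c - α ^ 2) * (c - (α ^ 2 + α)) := by grind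
    rw [Set.mem_ofPred_eq, ← sub_eq_zero, hc]
    simp [sub_eq_zero, or_assoc]
  have hcard : Nat.card {c : K // c ^ 3 = c + 1} = Set.ncard {c : K | c ^ 3 = c + 1} := rfl
  rw [hcard, h, Set.ncard_coe_finset, Finset.card_eq_three]
  exact ⟨α, α ^ 2, α ^ 2 + α, by grind, by grind, by grind, rfl⟩

theorem AddSubgroup.eq_top_of_cube_eq_add_one (hK : Nat.card K = 8) {c : K} (hc : c ^ 3 = c + 1)
    {M : AddSubgroup K} (h1 : 1 ∈ M) (hcM : c ∈ M) (hc2 : c ^ 2 ∈ M) : M = ⊤ := by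
  rw [AddSubgroup.eq_top_iff']
  intro z
  have h8 := pow_card_eight hK z
  have h : z * (z - 1) * (z - c) * (z - (c + 1)) * (z - c ^ 2) * (z - (c ^ 2 + 1)) *
    (z - (c ^ 2 + c)) * (z - (c ^ 2 + c + 1)) = 0 := by grind
  simp only [mul_eq_zero, sub_eq_zero, or_assoc] at h
  rcases h with rfl | rfl | rfl | rfl | rfl | rfl | rfl | rfl
  · exact M.zero_mem
  · exact h1
  · exact hcM
  · exact M.add_mem hcM h1
  · exact hc2
  · exact M.add_mem hc2 h1
  · exact M.add_mem hc2 hcM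
  · exact M.add_mem (M.add_mem hc2 hcM) h1

end FieldOfOrderEight


section SpecialLinear

namespace Matrix.SpecialLinearGroup

variable {K : Type*} [Field K]

theorem natCard_two_mul_units [Fintype K] :
    Nat.card SL(2, K) * Nat.card Kˣ =
      (Fintype.card K ^ 2 - 1) * (Fintype.card K ^ 2 - Fintype.card K) := by
  have hker : (toGL : SL(2, K) →* GL (Fin 2) K).range =
      (GeneralLinearGroup.det : GL (Fin 2) K →* Kˣ).ker := by
    ext g
    constructor
    · rintro ⟨s, rfl⟩
      exact Units.ext s.det_coe
    · intro hg
      exact ⟨⟨g, congrArg Units.val (MonoidHom.mem_ker.1 hg)⟩, Units.ext rfl⟩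
  have h := Subgroup.card_mul_index (GeneralLinearGroup.det : GL (Fin 2) K →* Kˣ).ker
  rw [Subgroup.index_ker, MonoidHom.range_eq_top.2 GeneralLinearGroup.det_surjective,
    Subgroup.card_top, ← hker,
    ← Nat.card_congr (MonoidHom.ofInjective toGL_injective).toEquiv, card_GL_field,
    Fin.prod_univ_two] at h
  simpa using h

theorem natCard_two_of_card_eight (hK : Nat.card K = 8) : Nat.card SL(2, K) = 504 := by
  have : Finite K := Nat.finite_of_card_ne_zero (by omega)
  have := Fintype.ofFinite K
  have h := natCard_two_mul_units (K := K)
  rw [Nat.card_units, ← Nat.card_eq_fintype_card, hK] at h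
  omega

theorem coe_transvection_zero_one (z : K) :
    (transvection (zero_ne_one : (0 : Fin 2) ≠ 1) z : Matrix (Fin 2) (Fin 2) K) =
      !![1, z; 0, 1] := by
  ext i j
  fin_cases i <;> fin_cases j <;> simp [transvection_coe]

theorem coe_transvection_one_zero (z : K) :
    (transvection (one_ne_zero : (1 : Fin 2) ≠ 0) z : Matrix (Fin 2) (Fin 2) K) =
      !![1, 0; z, 1] := by
  ext i j
  fin_cases i <;> fin_cases j <;> simp [transvection_coe]

variable [CharP K 2]

theorem center_eq_bot_of_charTwo : Subgroup.center SL(2, K) = ⊥ := by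
  rw [eq_bot_iff]
  intro A hA
  obtain ⟨r, hr, hA⟩ := mem_center_iff.1 hA
  have hr1 : r = 1 := by
    rw [Fintype.card_fin] at hr
    have : (r - 1) ^ 2 = 0 := by grind
    exact sub_eq_zero.1 (pow_eq_zero_iff two_ne_zero |>.1 this)
  exact Subgroup.mem_bot.2 (Subtype.ext (by rw [← hA, hr1]; simp))

/-- The coefficients of `A ^ n = u • A + w • 1`, as polynomials in the trace, can be computed
step by step with the Cayley-Hamilton theorem. -/
theorem coe_pow_succ_eq_smul_add (A : SL(2, K)) {n : ℕ} {u w : K}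
    (h : (A : Matrix (Fin 2) (Fin 2) K) ^ n = u • A.1 + w • 1) :
    (A : Matrix (Fin 2) (Fin 2) K) ^ (n + 1) = (u * trace A.1 + w) • A.1 + u • 1 := by
  have hdet : A 0 0 * A 1 1 - A 0 1 * A 1 0 = 1 := by
    rw [← det_fin_two]; exact A.det_coe
  have hsq : A.1 * A.1 = trace A.1 • A.1 + 1 := by
    ext i j
    fin_cases i <;> fin_cases j <;> simp [mul_apply, trace_fin_two, Fin.sum_univ_two] <;> grind
  rw [pow_succ, h, add_mul, smul_mul_assoc, hsq, smul_mul_assoc, one_mul]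
  module

theorem eq_zero_of_pow_eq_one {A : SL(2, K)} (hA : A ≠ 1) {n : ℕ} (hn : A ^ n = 1) {u w : K}
    (h : (A : Matrix (Fin 2) (Fin 2) K) ^ n = u • A.1 + w • 1) : u = 0 := by
  by_contra hu
  refine hA ?_
  have hdet : A 0 0 * A 1 1 - A 0 1 * A 1 0 = 1 := by
    rw [← det_fin_two]; exact A.det_coe
  rw [← coe_pow, hn, coe_one] at h
  have h00 := congrFun (congrFun h 0) 0
  have h01 := congrFun (congrFun h 0) 1
  have h10 := congrFun (congrFun h 1) 0
  have h11 := congrFun (congrFun h 1) 1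
  simp [hu] at h00 h01 h10 h11
  have hd : A 0 0 = A 1 1 := mul_left_cancel₀ hu (by grind)
  have h1 : (A 0 0 - 1) ^ 2 = 0 := by grind
  have h1 : A 0 0 = 1 := sub_eq_zero.1 (pow_eq_zero_iff two_ne_zero |>.1 h1)
  ext i j
  fin_cases i <;> fin_cases j <;> simp <;> grind

theorem coe_pow_two_eq_smul_add (A : SL(2, K)) :
    (A : Matrix (Fin 2) (Fin 2) K) ^ 2 = trace A.1 • A.1 + (1 : K) • 1 := by
  simpa using A.coe_pow_succ_eq_smul_add (n := 1) (u := 1) (w := 0) (by simp)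

theorem coe_pow_three_eq_smul_add (A : SL(2, K)) :
    (A : Matrix (Fin 2) (Fin 2) K) ^ 3 =
      (trace A.1 * trace A.1 + 1) • A.1 + trace A.1 • 1 :=
  A.coe_pow_succ_eq_smul_add A.coe_pow_two_eq_smul_add

theorem coe_pow_seven_eq_smul_add (A : SL(2, K)) :
    (A : Matrix (Fin 2) (Fin 2) K) ^ 7 =
      ((trace A.1 ^ 3 + trace A.1 ^ 2 + 1) ^ 2) • A.1 +
        (trace A.1 ^ 5 + trace A.1) • 1 := by
  rw [A.coe_pow_succ_eq_smul_add (A.coe_pow_succ_eq_smul_add (A.coe_pow_succ_eq_smul_add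
    (A.coe_pow_succ_eq_smul_add A.coe_pow_three_eq_smul_add)))]
  congr 2 <;> grind

theorem sq_eq_one_iff_trace {A : SL(2, K)} (hA : A ≠ 1) : A ^ 2 = 1 ↔ trace A.1 = 0 := by
  have h := A.coe_pow_two_eq_smul_add
  refine ⟨fun hn => eq_zero_of_pow_eq_one hA hn h, fun ht => Subtype.ext ?_⟩
  rw [coe_pow, h, ht, coe_one, zero_smul, zero_add, one_smul]

theorem pow_three_eq_one_iff_trace {A : SL(2, K)} (hA : A ≠ 1) : A ^ 3 = 1 ↔ trace A.1 = 1 := by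
  have h := A.coe_pow_three_eq_smul_add
  refine ⟨fun hn => ?_, fun ht => Subtype.ext ?_⟩
  · have h0 := eq_zero_of_pow_eq_one hA hn h
    have : (trace A.1 - 1) ^ 2 = 0 := by grind
    exact sub_eq_zero.1 (pow_eq_zero_iff two_ne_zero |>.1 this)
  · have h2 : (1 : K) * 1 + 1 = 0 := by grind
    rw [coe_pow, h, ht, coe_one, h2, zero_smul, zero_add, one_smul]

theorem pow_seven_eq_one_iff_trace {A : SL(2, K)} (hA : A ≠ 1) :
    A ^ 7 = 1 ↔ trace A.1 ^ 3 + trace A.1 ^ 2 + 1 = 0 := by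
  have h := A.coe_pow_seven_eq_smul_add
  refine ⟨fun hn => ?_, fun ht => Subtype.ext ?_⟩
  · exact pow_eq_zero_iff two_ne_zero |>.1 (eq_zero_of_pow_eq_one hA hn h)
  · have h5 : trace A.1 ^ 5 + trace A.1 = 1 := by grind
    rw [coe_pow, h, ht, h5, coe_one, zero_pow two_ne_zero, zero_smul, zero_add, one_smul]

/-- If `c ^ 3 = c + 1` then this element of order `3`, together with the transvection
`!![1, 1; 0, 1]`, is a Hurwitz pair. -/
def hurwitzElement {c : K} (hc : c ^ 3 = c + 1) : SL(2, K) :=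
  ⟨!![0, c ^ 2 + 1; c, 1], by rw [det_fin_two_of]; grind⟩

theorem coe_hurwitzElement {c : K} (hc : c ^ 3 = c + 1) :
    (hurwitzElement hc : Matrix (Fin 2) (Fin 2) K) = !![0, c ^ 2 + 1; c, 1] := rfl

theorem closure_transvection_hurwitzElement (hK : Nat.card K = 8) {c : K} (hc : c ^ 3 = c + 1) :
    Subgroup.closure {transvection (zero_ne_one : (0 : Fin 2) ≠ 1) (1 : K), hurwitzElement hc}
      = ⊤ := by
  set x : SL(2, K) := transvection zero_ne_one 1 with hx
  set y : SL(2, K) := hurwitzElement hc with hy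
  set H := Subgroup.closure {x, y}
  have hxH : x ∈ H := Subgroup.subset_closure (by simp)
  have hyH : y ∈ H := Subgroup.subset_closure (by simp)
  obtain ⟨u, huH, hu⟩ : ∃ u ∈ H, (u : Matrix (Fin 2) (Fin 2) K) = !![c, c ^ 2; c, 1] := by
    refine ⟨x * y, H.mul_mem hxH hyH, ?_⟩
    rw [coe_mul, hx, hy, coe_transvection_zero_one, coe_hurwitzElement, mul_fin_two]
    congr! 3 <;> grind
  obtain ⟨v, hvH, hv⟩ : ∃ v ∈ H,
      (v : Matrix (Fin 2) (Fin 2) K) = !![c + 1, c ^ 2 + 1; c, 0] := by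
    refine ⟨u * y, H.mul_mem huH hyH, ?_⟩
    rw [coe_mul, hu, hy, coe_hurwitzElement, mul_fin_two]
    congr! 3 <;> grind
  obtain ⟨p, hpH, hp⟩ : ∃ p ∈ H,
      (p : Matrix (Fin 2) (Fin 2) K) = !![c ^ 2 + c + 1, c; c ^ 2, c + 1] := by
    refine ⟨v * u, H.mul_mem hvH huH, ?_⟩
    rw [coe_mul, hv, hu, mul_fin_two]
    congr! 3 <;> grind
  obtain ⟨q, hqH, hq⟩ : ∃ q ∈ H,
      (q : Matrix (Fin 2) (Fin 2) K) = !![0, c; c ^ 2 + 1, c ^ 2] := by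
    refine ⟨v * p, H.mul_mem hvH hpH, ?_⟩
    rw [coe_mul, hv, hp, mul_fin_two]
    congr! 3 <;> grind
  let M : AddSubgroup K :=
    { carrier := {z | transvection zero_ne_one z ∈ H}
      zero_mem' := by
        rw [Set.mem_ofPred_eq, transvection_coeff_zero]; exact H.one_mem
      add_mem' := fun {a b} ha hb => by
        rw [Set.mem_ofPred_eq, transvection_add]; exact H.mul_mem ha hb
      neg_mem' := fun {a} ha => by
        rw [Set.mem_ofPred_eq, ← transvection_inv]; exact H.inv_mem ha }
  have hM : M = ⊤ := by
    have hM2 : c ^ 2 ∈ M := by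
      have h : transvection zero_ne_one (c ^ 2) = y * p * p * (p * p) := by
        refine Subtype.ext ?_
        simp only [coe_mul, hp, hy, coe_transvection_zero_one, coe_hurwitzElement, mul_fin_two]
        congr! 3 <;> grind
      change transvection zero_ne_one (c ^ 2) ∈ H
      exact h ▸ H.mul_mem (H.mul_mem (H.mul_mem hyH hpH) hpH) (H.mul_mem hpH hpH)
    have hM2' : c ^ 2 + c ∈ M := by
      have h : transvection zero_ne_one (c ^ 2 + c) = y * q * q := by
        refine Subtype.ext ?_
        simp only [coe_mul, hq, hy, coe_transvection_zero_one, coe_hurwitzElement, mul_fin_two]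
        congr! 3 <;> grind
      change transvection zero_ne_one (c ^ 2 + c) ∈ H
      exact h ▸ H.mul_mem (H.mul_mem hyH hqH) hqH
    exact AddSubgroup.eq_top_of_cube_eq_add_one hK hc hxH
      (by simpa using M.sub_mem hM2' hM2) hM2
  have hupper (z : K) : transvection zero_ne_one z ∈ H :=
    (hM ▸ AddSubgroup.mem_top z : z ∈ M)
  have hlower (z : K) : transvection (one_ne_zero : (1 : Fin 2) ≠ 0) z ∈ H := by
    have hz : transvection (one_ne_zero : (1 : Fin 2) ≠ 0) z =
        y * transvection zero_ne_one ((c ^ 2 + 1) ^ 2 * z) * y⁻¹ := by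
      rw [eq_mul_inv_iff_mul_eq]
      refine Subtype.ext ?_
      simp only [coe_mul, hy, coe_transvection_zero_one, coe_transvection_one_zero,
        coe_hurwitzElement, mul_fin_two]
      congr! 3 <;> grind
    rw [hz]
    exact H.mul_mem (H.mul_mem hyH (hupper _)) (H.inv_mem hyH)
  rw [Subgroup.eq_top_iff']
  refine SL2.transvection_induction (· ∈ H) (fun i j hij z => ?_) fun _ _ => H.mul_mem
  fin_cases i <;> fin_cases j
  · exact absurd rfl hij
  · exact hupper z
  · exact hlower z
  · exact absurd rfl hij

end Matrix.SpecialLinearGroup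

end SpecialLinear

section HurwitzPairs

/-- The pairs of elements of orders `2` and `3` whose product has order `7`. -/
def hurwitzPairs (G : Type*) [Group G] : Set (G × G) :=
  {p | (p.1 ^ 2 = 1 ∧ p.1 ≠ 1) ∧ (p.2 ^ 3 = 1 ∧ p.2 ≠ 1) ∧ (p.1 * p.2) ^ 7 = 1 ∧ p.1 * p.2 ≠ 1}

theorem MulAut.smul_mem_hurwitzPairs {G : Type*} [Group G] (φ : MulAut G) {p : G × G}
    (hp : p ∈ hurwitzPairs G) : φ • p ∈ hurwitzPairs G := by
  obtain ⟨⟨h1, h2⟩, ⟨h3, h4⟩, h5, h6⟩ := hp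
  refine ⟨⟨?_, ?_⟩, ⟨?_, ?_⟩, ?_, ?_⟩ <;>
    simp only [Prod.smul_fst, Prod.smul_snd, MulAut.smul_def, ← map_pow, ← map_mul, ne_eq,
      EmbeddingLike.map_eq_one_iff] <;> assumption

namespace Matrix.SpecialLinearGroup

variable {K : Type*} [Field K] [CharP K 2]

/-- The standard Hurwitz pair attached to a root `c` of `X ^ 3 - X - 1`. -/
def hurwitzPair {c : K} (hc : c ^ 3 = c + 1) : SL(2, K) × SL(2, K) :=
  (transvection zero_ne_one 1, hurwitzElement hc)

theorem coe_hurwitzPair_mul {c : K} (hc : c ^ 3 = c + 1) :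
    ((hurwitzPair hc).1 * (hurwitzPair hc).2 : Matrix (Fin 2) (Fin 2) K) =
      !![c, c ^ 2; c, 1] := by
  rw [hurwitzPair, coe_transvection_zero_one, coe_hurwitzElement, mul_fin_two]
  congr! 3 <;> grind

theorem hurwitzPair_mem {c : K} (hc : c ^ 3 = c + 1) : hurwitzPair hc ∈ hurwitzPairs SL(2, K) := by
  have h0 : c ≠ 0 := by rintro rfl; simp at hc
  have h1 : (hurwitzPair hc).1 ≠ 1 := fun h => by
    have := congrFun (congrFun (congrArg Subtype.val h) 0) 1
    simp [hurwitzPair, coe_transvection_zero_one] at this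
  have h2 : (hurwitzPair hc).2 ≠ 1 := fun h => by
    have := congrFun (congrFun (congrArg Subtype.val h) 1) 0
    simp [hurwitzPair, coe_hurwitzElement, h0] at this
  have h3 : (hurwitzPair hc).1 * (hurwitzPair hc).2 ≠ 1 := fun h => by
    have := congrFun (congrFun (congrArg Subtype.val h) 1) 0
    rw [coe_mul, coe_hurwitzPair_mul] at this
    simp [h0] at this
  refine ⟨⟨(sq_eq_one_iff_trace h1).2 ?_, h1⟩, ⟨(pow_three_eq_one_iff_trace h2).2 ?_, h2⟩,
    (pow_seven_eq_one_iff_trace h3).2 ?_, h3⟩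
  · rw [hurwitzPair, coe_transvection_zero_one, trace_fin_two_of]
    grind
  · rw [hurwitzPair, coe_hurwitzElement, trace_fin_two_of, zero_add]
  · rw [coe_mul, coe_hurwitzPair_mul, trace_fin_two_of]
    grind

theorem exists_smul_hurwitzPair_eq (hK : Nat.card K = 8) {p : SL(2, K) × SL(2, K)}
    (hp : p ∈ hurwitzPairs SL(2, K)) :
    ∃ (g : SL(2, K)) (c : K) (hc : c ^ 3 = c + 1), MulAut.conj g • hurwitzPair hc = p := by
  obtain ⟨x, y⟩ := p
  obtain ⟨⟨h1, h2⟩, ⟨h3, h4⟩, h5, h6⟩ := hp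
  dsimp only at h1 h2 h3 h4 h5 h6
  rw [sq_eq_one_iff_trace h2] at h1
  rw [pow_three_eq_one_iff_trace h4] at h3
  rw [pow_seven_eq_one_iff_trace h6] at h5
  have hroot (z : K) : ∃ w, w ^ 2 = z := ⟨z ^ 4, by rw [← pow_mul, pow_card_eight hK]⟩
  obtain ⟨P, hP⟩ := hroot (x 0 1)
  obtain ⟨Q, hQ⟩ := hroot (x 1 0)
  have hdx : x 0 0 * x 1 1 - x 0 1 * x 1 0 = 1 := by rw [← det_fin_two]; exact x.det_coe
  have hdy : y 0 0 * y 1 1 - y 0 1 * y 1 0 = 1 := by rw [← det_fin_two]; exact y.det_coe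
  rw [trace_fin_two] at h1 h3
  change x 0 0 + x 1 1 = 0 at h1
  change y 0 0 + y 1 1 = 1 at h3
  have hx1 : x 1 1 = x 0 0 := by grind
  have hx0 : x 0 0 = 1 + P * Q := by
    have : (x 0 0 - (1 + P * Q)) ^ 2 = 0 := by grind
    exact sub_eq_zero.1 (pow_eq_zero_iff two_ne_zero |>.1 this)
  have hx : x.1 = !![1 + P * Q, P ^ 2; Q ^ 2, 1 + P * Q] := by
    rw [eta_fin_two x.1]
    rw [hP, hQ, hx1, hx0]
  obtain ⟨r, s, t, hy⟩ : ∃ r s t, y.1 = !![r, s; t, r + 1] := by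
    refine ⟨y 0 0, y 0 1, y 1 0, (eta_fin_two y.1).trans ?_⟩
    rw [show y 1 1 = y 0 0 + 1 by grind]
  have hdet : r * (r + 1) - s * t = 1 := by
    have := y.det_coe
    rwa [hy, det_fin_two_of] at this
  obtain ⟨c, hcdef⟩ : ∃ c, c = P ^ 2 * t + P * Q + Q ^ 2 * s := ⟨_, rfl⟩
  have hc : c ^ 3 = c + 1 := by
    rw [coe_mul, hx, hy, mul_fin_two, trace_fin_two_of,
      show (1 + P * Q) * r + P ^ 2 * t + (Q ^ 2 * s + (1 + P * Q) * (r + 1)) = c + 1 by grind] at h5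
    grind
  have hcc : (c ^ 2 + 1) * c = 1 := by grind
  let h : SL(2, K) := ⟨!![P, (c ^ 2 + 1) * (r * P + s * Q);
    Q, (c ^ 2 + 1) * (t * P + (r + 1) * Q)], by rw [det_fin_two_of]; grind⟩
  have hh : h.1 = !![P, (c ^ 2 + 1) * (r * P + s * Q);
    Q, (c ^ 2 + 1) * (t * P + (r + 1) * Q)] := rfl
  refine ⟨h, c, hc, Prod.ext ?_ ?_⟩
  · change h * transvection zero_ne_one 1 * h⁻¹ = x
    rw [mul_inv_eq_iff_eq_mul]
    refine Subtype.ext ?_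
    rw [coe_mul, coe_mul, hh, hx, coe_transvection_zero_one, mul_fin_two, mul_fin_two]
    congr! 3 <;> grind
  · change h * hurwitzElement hc * h⁻¹ = y
    rw [mul_inv_eq_iff_eq_mul]
    refine Subtype.ext ?_
    rw [coe_mul, coe_mul, hh, hy, coe_hurwitzElement, mul_fin_two, mul_fin_two]
    congr! 3 <;> grind

theorem closure_of_mem_hurwitzPairs (hK : Nat.card K = 8) {p : SL(2, K) × SL(2, K)}
    (hp : p ∈ hurwitzPairs SL(2, K)) : Subgroup.closure {p.1, p.2} = ⊤ := by
  obtain ⟨g, c, hc, rfl⟩ := exists_smul_hurwitzPair_eq hK hp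
  have h := congrArg (Subgroup.map (MulAut.conj g).toMonoidHom)
    (closure_transvection_hurwitzElement hK hc)
  rwa [MonoidHom.map_closure, Set.image_pair,
    Subgroup.map_top_of_surjective _ (MulAut.conj g).surjective] at h

theorem natCard_hurwitzPairs (hK : Nat.card K = 8) : Nat.card (hurwitzPairs SL(2, K)) = 1512 := by
  let F : SL(2, K) × {c : K // c ^ 3 = c + 1} → hurwitzPairs SL(2, K) := fun q =>
    ⟨MulAut.conj q.1 • hurwitzPair q.2.2, MulAut.smul_mem_hurwitzPairs _ (hurwitzPair_mem q.2.2)⟩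
  have hF : Function.Bijective F := by
    refine ⟨?_, fun ⟨p, hp⟩ => ?_⟩
    · rintro ⟨g, c, hc⟩ ⟨g', c', hc'⟩ h
      replace h : MulAut.conj g • hurwitzPair hc = MulAut.conj g' • hurwitzPair hc' :=
        congrArg Subtype.val h
      have htr (g : SL(2, K)) {c : K} (hc : c ^ 3 = c + 1) :
          trace ((MulAut.conj g • hurwitzPair hc).1 * (MulAut.conj g • hurwitzPair hc).2).1
            = c + 1 := by
        have : (MulAut.conj g • hurwitzPair hc).1 * (MulAut.conj g • hurwitzPair hc).2 =
            g * ((hurwitzPair hc).1 * (hurwitzPair hc).2) * g⁻¹ :=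
          (map_mul (MulAut.conj g) _ _).symm
        rw [this, coe_mul, trace_mul_comm, ← coe_mul, inv_mul_cancel_left, coe_mul,
          coe_hurwitzPair_mul, trace_fin_two_of]
      obtain rfl : c = c' := add_right_cancel ((htr g hc).symm.trans (h ▸ htr g' hc'))
      have hg : MulAut.conj (g'⁻¹ * g) • hurwitzPair hc = hurwitzPair hc := by
        rw [map_mul, mul_smul, h, map_inv, inv_smul_smul]
      have hcent : g'⁻¹ * g ∈ Subgroup.center SL(2, K) := by
        rw [← Subgroup.centralizer_univ, ← Subgroup.coe_top,
          ← closure_transvection_hurwitzElement hK hc, Subgroup.centralizer_closure]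
        rintro _ (rfl | rfl)
        · exact (mul_inv_eq_iff_eq_mul.1 (congrArg Prod.fst hg)).symm
        · exact (mul_inv_eq_iff_eq_mul.1 (congrArg Prod.snd hg)).symm
      rw [center_eq_bot_of_charTwo, Subgroup.mem_bot, inv_mul_eq_one] at hcent
      rw [hcent]
    · obtain ⟨g, c, hc, rfl⟩ := exists_smul_hurwitzPair_eq hK hp
      exact ⟨⟨g, c, hc⟩, rfl⟩
  rw [← Nat.card_congr (Equiv.ofBijective F hF), Nat.card_prod, natCard_two_of_card_eight hK,
    natCard_cube_eq_add_one hK]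

theorem natCard_mulAut_dvd (hK : Nat.card K = 8) : Nat.card (MulAut SL(2, K)) ∣ 1512 := by
  rw [← natCard_hurwitzPairs hK]
  exact MulAut.card_dvd_card_of_closure_eq_top
    (fun φ _ => φ.smul_mem_hurwitzPairs) fun _ => closure_of_mem_hurwitzPairs hK

end Matrix.SpecialLinearGroup

namespace Matrix.ProjectiveSpecialLinearGroup

variable {K : Type*} [Field K] [CharP K 2]

variable (K) in
/-- In characteristic `2` the projection from `SL(2, K)` to `PSL(2, K)` is an isomorphism. -/
noncomputable def equivOfCharTwo : PSL(2, K) ≃* SL(2, K) :=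
  (QuotientGroup.quotientMulEquivOfEq
    SpecialLinearGroup.center_eq_bot_of_charTwo).trans QuotientGroup.quotientBot

theorem natCard_mulAut_dvd (hK : Nat.card K = 8) : Nat.card (MulAut PSL(2, K)) ∣ 1512 := by
  rw [Nat.card_congr (MulAut.congr (equivOfCharTwo K)).toEquiv]
  exact SpecialLinearGroup.natCard_mulAut_dvd hK

theorem natCard_two_of_card_eight (hK : Nat.card K = 8) : Nat.card PSL(2, K) = 504 := by
  rw [Nat.card_congr (equivOfCharTwo K).toEquiv, SpecialLinearGroup.natCard_two_of_card_eight hK]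

theorem conj_injective_of_charTwo :
    Function.Injective (MulAut.conj : PSL(2, K) →* MulAut PSL(2, K)) := by
  refine (injective_iff_map_eq_one _).2 fun g hg => (equivOfCharTwo K).injective ?_
  rw [map_one, ← Subgroup.mem_bot, ← SpecialLinearGroup.center_eq_bot_of_charTwo,
    Subgroup.mem_center_iff]
  intro a
  obtain ⟨a, rfl⟩ := (equivOfCharTwo K).surjective a
  rw [← map_mul, ← map_mul]
  have := DFunLike.congr_fun hg a
  rw [MulAut.conj_apply, MulAut.one_apply, mul_inv_eq_iff_eq_mul] at this
  rw [this]

end Matrix.ProjectiveSpecialLinearGroup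

end HurwitzPairs

/-- Lemma 2.6: the group `PSL(2,8):3 ≅ Aut(PSL(2,8))` has no factorisation `G = AB`
with `A`, `B` proper subgroups of equal order. -/
theorem no_homogeneous_factorisation_PSL28_3
    (A B : Subgroup (MulAut PSL(2, GaloisField 2 3)))
    (hA : A ≠ ⊤) (hB : B ≠ ⊤)
    (hfac : (A : Set (MulAut PSL(2, GaloisField 2 3))) * (B : Set (MulAut PSL(2, GaloisField 2 3))) = Set.univ) :
    Nat.card A ≠ Nat.card B := by
  have hK : Nat.card (GaloisField 2 3) = 8 := GaloisField.card 2 3 (by norm_num)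
  have : IsSimpleGroup PSL(2, GaloisField 2 3) :=
    Matrix.ProjectiveSpecialLinearGroup.rank_two_simple (by omega)
  exact Subgroup.card_ne_card_of_mul_eq_univ_of_isSimpleGroup MulAut.conj
    Matrix.ProjectiveSpecialLinearGroup.conj_injective_of_charTwo
    (Matrix.ProjectiveSpecialLinearGroup.natCard_two_of_card_eight hK)
    (Matrix.ProjectiveSpecialLinearGroup.natCard_mulAut_dvd hK) hA hB hfac
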